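/- Let G be a deterministic labeled graph over an alphabet Σ partitioned into Σ0 and Σ1, and let n0, n1 be positive integers such that X(A_{G_0},A_{G_1},n0+1,n1+1) ≠ ∅. Then there exists an (S(G),n0,n1)-encoder E whose anticipation is at most a, where a = 1 + min over x ∈ X(A_{G_0},A_{G_1},n0+1,n1+1) of ⌈log_{n+1} ‖x‖_∞⌉ and n = min{n0,n1}. Furthermore, if G has finite memory μ, then E can be chosen to be (μ,a)-definite. -/

import Mathlib

open scoped Classical

/-- A finite labeled directed graph over alphabet `A`: a nonempty finite set of
states, a finite set of edges each with an initial and terminal state, and a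
labeling of edges by symbols of `A`. -/
structure LGraph (A : Type u) where
  V : Type u
  [fintypeV : Fintype V]
  [nonemptyV : Nonempty V]
  E : Type u
  [fintypeE : Fintype E]
  src : E → V
  dst : E → V
  lab : E → A

attribute [instance] LGraph.fintypeV LGraph.nonemptyV LGraph.fintypeE

namespace LGraph

variable {A : Type*}

/-- `G.IsWalk u es` : `es` is a sequence of consecutive edges starting at `u`. -/
def IsWalk (G : LGraph A) : G.V → List G.E → Prop
  | _, [] => True
  | u, e :: es => G.src e = u ∧ G.IsWalk (G.dst e) es

/-- The terminal state of a walk. -/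
def endState (G : LGraph A) : G.V → List G.E → G.V
  | u, [] => u
  | _, e :: es => G.endState (G.dst e) es

/-- The constraint `S(G)` presented by `G`: all words generated by finite paths. -/
def constraint (G : LGraph A) : Set (List A) :=
  { w | ∃ u es, G.IsWalk u es ∧ es.map G.lab = w }

/-- No state has two distinct outgoing edges with the same label. -/
def Deterministic (G : LGraph A) : Prop :=
  ∀ e e' : G.E, G.src e = G.src e' → G.lab e = G.lab e' → e = e'

/-- No two distinct paths with the same initial state and the same terminal
state generate the same word. -/
def Lossless (G : LGraph A) : Prop :=
  ∀ (u : G.V) (es es' : List G.E), G.IsWalk u es → G.IsWalk u es' →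
    G.endState u es = G.endState u es' → es.map G.lab = es'.map G.lab → es = es'

/-- Strong connectivity. -/
def Irreducible (G : LGraph A) : Prop :=
  ∀ u v : G.V, ∃ es : List G.E, G.IsWalk u es ∧ G.endState u es = v

/-- Primitivity (in the equivalent form: some power of the adjacency matrix is
entrywise positive, i.e. there is a uniform positive length `ℓ` such that any
state can be reached from any state by a walk of length `ℓ`). -/
def Primitive (G : LGraph A) : Prop :=
  ∃ ℓ : ℕ, 0 < ℓ ∧ ∀ u v : G.V, ∃ es : List G.E,
    G.IsWalk u es ∧ es.length = ℓ ∧ G.endState u es = v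

/-- The adjacency matrix of the subgraph of `G` consisting of the edges whose
labels lie in `P`: its `(u,v)` entry is the number of edges from `u` to `v`
with label in `P`. -/
noncomputable def subAdj (G : LGraph A) (P : Set A) : G.V → G.V → ℕ :=
  fun u v => Nat.card {e : G.E // G.src e = u ∧ G.dst e = v ∧ G.lab e ∈ P}

/-- Every state has exactly `n` outgoing edges with label in `P`. -/
def OutDeg (G : LGraph A) (P : Set A) (n : ℕ) : Prop :=
  ∀ u : G.V, Nat.card {e : G.E // G.src e = u ∧ G.lab e ∈ P} = n

/-- An `(S, n0, n1)`-encoder with respect to the even/odd symbol sets `S0, S1`: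
a lossless graph whose constraint is contained in `S` and in which every state
has exactly `n0` outgoing edges with even labels and exactly `n1` outgoing
edges with odd labels. -/
def IsEncoder (En : LGraph A) (S : Set (List A)) (S0 S1 : Set A) (n0 n1 : ℕ) : Prop :=
  En.Lossless ∧ En.constraint ⊆ S ∧ En.OutDeg S0 n0 ∧ En.OutDeg S1 n1

/-- `x ∈ X(A_{G_0}, A_{G_1}, n0, n1)`: a nonnegative nonzero integer vector with
`A_{G_0} x ≥ n0 x` and `A_{G_1} x ≥ n1 x` componentwise. -/
def InX (G : LGraph A) (S0 S1 : Set A) (n0 n1 : ℕ) (x : G.V → ℕ) : Prop :=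
  x ≠ 0 ∧ (∀ u, n0 * x u ≤ ∑ v, G.subAdj S0 u v * x v)
        ∧ (∀ u, n1 * x u ≤ ∑ v, G.subAdj S1 u v * x v)

/-- The graph has anticipation at most `a`: all paths from a common state that
generate the same word of length `a+1` share the same first edge. -/
def AnticipationAtMost (G : LGraph A) (a : ℕ) : Prop :=
  ∀ (u : G.V) (es es' : List G.E), G.IsWalk u es → G.IsWalk u es' →
    es.length = a + 1 → es'.length = a + 1 → es.map G.lab = es'.map G.lab →
    es.head? = es'.head?

/-- The graph has memory at most `μ`: all paths of length `μ` generating the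
same word terminate in the same state. -/
def MemoryAtMost (G : LGraph A) (μ : ℕ) : Prop :=
  ∀ (u u' : G.V) (es es' : List G.E), G.IsWalk u es → G.IsWalk u' es' →
    es.length = μ → es'.length = μ → es.map G.lab = es'.map G.lab →
    G.endState u es = G.endState u' es'

/-- `(m,a)`-definiteness: all paths generating a given word of length `m+a+1`
share the same `(m+1)`-st edge. -/
def Definite (G : LGraph A) (m a : ℕ) : Prop :=
  ∀ (u u' : G.V) (es es' : List G.E), G.IsWalk u es → G.IsWalk u' es' →
    es.length = m + a + 1 → es'.length = m + a + 1 → es.map G.lab = es'.map G.lab →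
    es[m]? = es'[m]?

end LGraph

namespace LGraph

/-- The members of a finite family of intervals can be laid out consecutively. -/
theorem exists_offset {ι : Type*} [Fintype ι] (y : ι → ℕ) :
    ∃ off : ι → ℕ,
      (∀ i i' j j', j < y i → j' < y i' → off i + j = off i' + j' → i = i' ∧ j = j') ∧
      ∀ p < ∑ i, y i, ∃ i j, j < y i ∧ off i + j = p := by
  let g := Fintype.equivFin ι
  let z : Fin (Fintype.card ι) → ℕ := fun k => y (g.symm k)
  refine ⟨fun i => ∑ k : Fin (g i).1, z (k.castLE (g i).2.le), ?_, ?_⟩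
  · intro i i' j j' hj hj' h
    have key := (finSigmaFinEquiv (n := z)).injective
      (a₁ := ⟨g i, j, by simpa [z] using hj⟩) (a₂ := ⟨g i', j', by simpa [z] using hj'⟩)
      (by
        apply Fin.ext
        rw [finSigmaFinEquiv_apply, finSigmaFinEquiv_apply]
        exact h)
    have hi : i = i' := g.injective (congrArg Sigma.fst key)
    subst hi
    exact ⟨rfl, by simpa using h⟩
  · intro p hp
    have hsum : ∑ k, z k = ∑ i, y i := g.symm.sum_comp y
    obtain ⟨⟨k, j⟩, hkj⟩ := (finSigmaFinEquiv (n := z)).surjective ⟨p, hsum ▸ hp⟩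
    have hp' := congrArg Fin.val hkj
    rw [finSigmaFinEquiv_apply] at hp'
    obtain ⟨i, rfl⟩ := g.surjective k
    exact ⟨i, j, by simpa [z] using j.2, hp'⟩

variable {A : Type*}

theorem sum_subAdj_mul (G : LGraph A) (P : Set A) (x : G.V → ℕ) (u : G.V) :
    ∑ v, G.subAdj P u v * x v = ∑ e : {e : G.E // G.src e = u ∧ G.lab e ∈ P}, x (G.dst e) := by
  rw [← Finset.sum_subtype (Finset.univ.filter fun e => G.src e = u ∧ G.lab e ∈ P)
    (by simp) (fun e => x (G.dst e)), ← Finset.sum_fiberwise _ G.dst]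
  refine Finset.sum_congr rfl fun v _ => ?_
  rw [Finset.sum_congr rfl (g := fun _ => x v) (by simp +contextual), Finset.sum_const,
    smul_eq_mul, subAdj, Nat.card_eq_fintype_card, Fintype.card_subtype, Finset.filter_filter]
  congr 2
  ext e
  simp only [Finset.mem_filter]
  tauto

/-- `off` lays out the intervals `[0, x (G.dst e))`, over the edges `e` leaving a given state
with labels in `P`, consecutively. -/
def IsLayout (G : LGraph A) (P : Set A) (x : G.V → ℕ) (off : G.E → ℕ) : Prop :=
  (∀ e e' j j', G.lab e ∈ P → G.lab e' ∈ P → G.src e = G.src e' →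
    j < x (G.dst e) → j' < x (G.dst e') → off e + j = off e' + j' → e = e' ∧ j = j') ∧
  ∀ u, ∀ p < ∑ v, G.subAdj P u v * x v,
    ∃ e j, G.src e = u ∧ G.lab e ∈ P ∧ j < x (G.dst e) ∧ off e + j = p

theorem IsLayout.congr {G : LGraph A} {P : Set A} {x : G.V → ℕ} {off off' : G.E → ℕ}
    (h : G.IsLayout P x off) (hoff : ∀ e, G.lab e ∈ P → off' e = off e) :
    G.IsLayout P x off' := by
  refine ⟨fun e e' j j' he he' hs hj hj' heq => ?_, fun u p hp => ?_⟩
  · rw [hoff e he, hoff e' he'] at heq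
    exact h.1 e e' j j' he he' hs hj hj' heq
  · obtain ⟨e, j, hs, he, hj, heq⟩ := h.2 u p hp
    exact ⟨e, j, hs, he, hj, (hoff e he).symm ▸ heq⟩

theorem exists_isLayout (G : LGraph A) (P : Set A) (x : G.V → ℕ) :
    ∃ off, G.IsLayout P x off := by
  choose o hinj hsurj using fun u =>
    exists_offset fun e : {e : G.E // G.src e = u ∧ G.lab e ∈ P} => x (G.dst e)
  have ho : ∀ u e (h : G.src e = u ∧ G.lab e ∈ P),
      (if h : G.lab e ∈ P then o (G.src e) ⟨e, rfl, h⟩ else 0) = o u ⟨e, h⟩ := by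
    rintro u e ⟨rfl, h⟩
    exact dif_pos h
  refine ⟨fun e => if h : G.lab e ∈ P then o (G.src e) ⟨e, rfl, h⟩ else 0, ?_, ?_⟩
  · intro e e' j j' he he' hs hj hj' h
    beta_reduce at h
    rw [ho (G.src e') e ⟨hs, he⟩, ho (G.src e') e' ⟨rfl, he'⟩] at h
    obtain ⟨h1, h2⟩ := hinj _ _ _ _ _ hj hj' h
    exact ⟨congrArg Subtype.val h1, h2⟩
  · intro u p hp
    rw [sum_subAdj_mul] at hp
    obtain ⟨⟨e, he⟩, j, hj, rfl⟩ := hsurj u p hp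
    exact ⟨e, j, he.1, he.2, hj, congrArg (· + j) (ho u e he)⟩

/-- The punctured splitting of `G` by the weights `x`: the states above `u` are the pairs `(u, i)`
with `i < x u`, the pairs `(e, j)` with `G.src e = u` sit at positions `off e + j`, and `(u, i)`
receives the pairs in the `i`-th block of length `d e + 1`, except the last of the block. -/
noncomputable def punctured (G : LGraph A) (x : G.V → ℕ) (hx : x ≠ 0) (off d : G.E → ℕ) :
    LGraph A where
  V := {p : G.V × ℕ // p.2 < x p.1}
  fintypeV :=
    have : Finite {p : G.V × ℕ // p.2 < x p.1} :=
      Finite.of_injective (β := Σ v, Fin (x v)) (fun p => ⟨p.1.1, p.1.2, p.2⟩) (by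
        rintro ⟨⟨a, b⟩, h⟩ ⟨⟨c, d⟩, h'⟩ heq
        grind)
    Fintype.ofFinite _
  nonemptyV := by
    obtain ⟨v, hv⟩ := Function.ne_iff.mp hx
    exact ⟨⟨(v, 0), Nat.pos_of_ne_zero hv⟩⟩
  E := {p : G.E × ℕ // p.2 < x (G.dst p.1) ∧ (off p.1 + p.2) % (d p.1 + 1) ≠ d p.1 ∧
    (off p.1 + p.2) / (d p.1 + 1) < x (G.src p.1)}
  fintypeE :=
    have : Finite {p : G.E × ℕ // p.2 < x (G.dst p.1) ∧ (off p.1 + p.2) % (d p.1 + 1) ≠ d p.1 ∧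
        (off p.1 + p.2) / (d p.1 + 1) < x (G.src p.1)} :=
      Finite.of_injective (β := Σ e, Fin (x (G.dst e))) (fun p => ⟨p.1.1, p.1.2, p.2.1⟩) (by
        rintro ⟨⟨a, b⟩, h⟩ ⟨⟨c, d⟩, h'⟩ heq
        grind)
    Fintype.ofFinite _
  src p := ⟨(G.src p.1.1, (off p.1.1 + p.1.2) / (d p.1.1 + 1)), p.2.2.2⟩
  dst p := ⟨(G.dst p.1.1, p.1.2), p.2.1⟩
  lab p := G.lab p.1.1

theorem IsWalk.append {G : LGraph A} {es es' : List G.E} {u : G.V} (h : G.IsWalk u (es ++ es')) :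
    G.IsWalk u es ∧ G.IsWalk (G.endState u es) es' := by
  induction es generalizing u with
  | nil => exact ⟨trivial, h⟩
  | cons e es ih => exact ⟨⟨h.1, (ih h.2).1⟩, (ih h.2).2⟩

section Punctured

variable {G : LGraph A} {x : G.V → ℕ} {hx : x ≠ 0} {off d : G.E → ℕ}

theorem punctured_isWalk_map {s : (G.punctured x hx off d).V}
    {es : List (G.punctured x hx off d).E} (h : (G.punctured x hx off d).IsWalk s es) :
    G.IsWalk s.1.1 (es.map fun f => f.1.1) := by
  induction es generalizing s with
  | nil => trivial
  | cons f es ih => exact ⟨congrArg (fun s => s.1.1) h.1, ih h.2⟩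

theorem punctured_endState_map (s : (G.punctured x hx off d).V)
    (es : List (G.punctured x hx off d).E) :
    G.endState s.1.1 (es.map fun f => f.1.1) =
      ((G.punctured x hx off d).endState s es).1.1 := by
  induction es generalizing s with
  | nil => rfl
  | cons f es ih => exact ih ((G.punctured x hx off d).dst f)

theorem punctured_map_lab (es : List (G.punctured x hx off d).E) :
    (es.map fun f => f.1.1).map G.lab = es.map (G.punctured x hx off d).lab := by
  rw [List.map_map]
  rfl

theorem punctured_constraint : (G.punctured x hx off d).constraint ⊆ G.constraint := by
  rintro w ⟨s, es, h, rfl⟩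
  exact ⟨s.1.1, _, punctured_isWalk_map h, punctured_map_lab es⟩

/-- Edges leaving states above the same state of `G` and carrying the same label lie above the
same edge of `G`. -/
theorem punctured_edge_eq (hdet : G.Deterministic) {f f' : (G.punctured x hx off d).E}
    (hs : ((G.punctured x hx off d).src f).1.1 = ((G.punctured x hx off d).src f').1.1)
    (hl : (G.punctured x hx off d).lab f = (G.punctured x hx off d).lab f') : f.1.1 = f'.1.1 :=
  hdet _ _ hs hl

theorem punctured_eq_of_endState (hdet : G.Deterministic)
    {es es' : List (G.punctured x hx off d).E} {s s' : (G.punctured x hx off d).V}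
    (h : (G.punctured x hx off d).IsWalk s es) (h' : (G.punctured x hx off d).IsWalk s' es')
    (hs : s.1.1 = s'.1.1)
    (hend : (G.punctured x hx off d).endState s es = (G.punctured x hx off d).endState s' es')
    (hl : es.map (G.punctured x hx off d).lab = es'.map (G.punctured x hx off d).lab) :
    es = es' ∧ s = s' := by
  induction es generalizing es' s s' with
  | nil =>
    obtain rfl : es' = [] := by simpa using hl.symm
    exact ⟨rfl, hend⟩
  | cons f es ih =>
    obtain _ | ⟨f', es'⟩ := es'
    · simp at hl
    rw [List.map_cons, List.map_cons, List.cons.injEq] at hl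
    obtain ⟨rfl, h⟩ := h
    obtain ⟨rfl, h'⟩ := h'
    have he := punctured_edge_eq hdet hs hl.1
    obtain ⟨rfl, hd⟩ := ih h h' (congrArg G.dst he) hend hl.2
    obtain rfl : f = f' :=
      Subtype.ext (Prod.ext he (congrArg (fun s => s.1.2) hd))
    exact ⟨rfl, rfl⟩

theorem punctured_lossless (hdet : G.Deterministic) : (G.punctured x hx off d).Lossless :=
  fun _ _ _ h h' hend hl => (punctured_eq_of_endState hdet h h' rfl hend hl).1

theorem punctured_outDeg {P : Set A} {n : ℕ} (hd : ∀ e, G.lab e ∈ P → d e = n)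
    (hoff : G.IsLayout P x off)
    (hxP : ∀ u, (n + 1) * x u ≤ ∑ v, G.subAdj P u v * x v) :
    (G.punctured x hx off d).OutDeg P n := by
  rintro ⟨⟨u, i⟩, hi⟩
  rw [← Nat.card_fin n]
  refine Nat.card_eq_of_bijective (fun f => ⟨(off f.1.1.1 + f.1.1.2) % (n + 1), ?_⟩) ⟨?_, ?_⟩
  · obtain ⟨f, hf, hP⟩ := f
    have h1 := f.2.2.1
    rw [hd _ hP] at h1
    have := Nat.mod_lt (off f.1.1 + f.1.2) (Nat.add_one_pos n)
    simp only
    omega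
  · rintro ⟨f, hf, hP⟩ ⟨f', hf', hP'⟩ h
    have h0 : (off f.1.1 + f.1.2) % (n + 1) = (off f'.1.1 + f'.1.2) % (n + 1) :=
      congrArg Fin.val h
    have h1 : (off f.1.1 + f.1.2) / (d f.1.1 + 1) = i := congrArg (fun s => s.1.2) hf
    have h1' : (off f'.1.1 + f'.1.2) / (d f'.1.1 + 1) = i := congrArg (fun s => s.1.2) hf'
    rw [hd _ hP] at h1
    rw [hd _ hP'] at h1'
    have h2 : off f.1.1 + f.1.2 = off f'.1.1 + f'.1.2 := by
      rw [← Nat.div_add_mod (off f.1.1 + f.1.2) (n + 1), h0, h1, ← h1', Nat.div_add_mod]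
    have hs : G.src f.1.1 = G.src f'.1.1 := congrArg (fun s => s.1.1) (hf.trans hf'.symm)
    obtain ⟨h3, h4⟩ := hoff.1 _ _ _ _ hP hP' hs f.2.1 f'.2.1 h2
    exact Subtype.ext (Subtype.ext (Prod.ext h3 h4))
  · rintro ⟨r, hr⟩
    have hlt : (n + 1) * i + r < (n + 1) * x u := by
      have : (n + 1) * (i + 1) ≤ (n + 1) * x u := Nat.mul_le_mul_left _ hi
      linarith
    obtain ⟨e, j, rfl, hP, hj, hp⟩ := hoff.2 u _ (hlt.trans_le (hxP u))
    have hmod : (off e + j) % (n + 1) = r := by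
      rw [hp, Nat.mul_add_mod, Nat.mod_eq_of_lt (by omega)]
    have hdiv : (off e + j) / (n + 1) = i := by
      rw [hp, Nat.mul_add_div n.succ_pos, Nat.div_eq_of_lt (by omega), add_zero]
    refine ⟨⟨⟨(e, j), hj, ?_, ?_⟩, Subtype.ext (Prod.ext rfl ?_), hP⟩, Fin.ext hmod⟩
    · rw [hd _ hP, hmod]
      exact hr.ne
    · rw [hd _ hP, hdiv]
      exact hi
    · change (off e + j) / (d e + 1) = i
      rw [hd _ hP, hdiv]

/-- States above the same state of `G` from which a common word of length `L ≤ k` can be generated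
have close indices. -/
theorem punctured_index_le (hdet : G.Deterministic) {n k : ℕ} (hd : ∀ e, n ≤ d e)
    (hk : ∀ v, x v ≤ (n + 1) ^ k) {es es' : List (G.punctured x hx off d).E}
    {s s' : (G.punctured x hx off d).V}
    (h : (G.punctured x hx off d).IsWalk s es) (h' : (G.punctured x hx off d).IsWalk s' es')
    (hs : s.1.1 = s'.1.1)
    (hl : es.map (G.punctured x hx off d).lab = es'.map (G.punctured x hx off d).lab)
    (hlen : es.length ≤ k) :
    s.1.2 ≤ s'.1.2 + (n + 1) ^ (k - es.length) := by
  induction es generalizing es' s s' with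
  | nil => exact (s.2.le.trans (hk _)).trans (Nat.le_add_left _ _)
  | cons f es ih =>
    obtain _ | ⟨f', es'⟩ := es'
    · simp at hl
    rw [List.map_cons, List.map_cons, List.cons.injEq] at hl
    rw [List.length_cons] at hlen ⊢
    obtain ⟨rfl, h⟩ := h
    obtain ⟨rfl, h'⟩ := h'
    have he := punctured_edge_eq hdet hs hl.1
    have hj : f.1.2 ≤ f'.1.2 + (n + 1) ^ (k - es.length) :=
      ih h h' (congrArg G.dst he) hl.2 (by omega)
    change (off f.1.1 + f.1.2) / (d f.1.1 + 1) ≤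
      (off f'.1.1 + f'.1.2) / (d f'.1.1 + 1) + (n + 1) ^ (k - (es.length + 1))
    rw [← he, ← Nat.add_mul_div_left _ _ (Nat.succ_pos _)]
    refine Nat.div_le_div_right ?_
    rw [show k - es.length = k - (es.length + 1) + 1 by omega, pow_succ'] at hj
    have := Nat.mul_le_mul_right ((n + 1) ^ (k - (es.length + 1))) (Nat.succ_le_succ (hd f.1.1))
    simp only [Nat.succ_eq_add_one] at this ⊢
    omega

theorem div_le_div_of_le_succ {p q m : ℕ} (hq : q % (m + 1) ≠ m) (h : p ≤ q + 1) :
    p / (m + 1) ≤ q / (m + 1) := by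
  refine (Nat.div_le_div_right h).trans ?_
  rw [Nat.succ_div, if_neg, add_zero]
  intro hdvd
  have h1 := Nat.mod_eq_zero_of_dvd hdvd
  have h2 := Nat.mod_lt q m.succ_pos
  rw [Nat.add_mod_eq_ite, Nat.mod_eq_of_lt (a := 1)] at h1 <;> grind

theorem punctured_index_eq (hdet : G.Deterministic) {n k : ℕ} (hd : ∀ e, n ≤ d e)
    (hk : ∀ v, x v ≤ (n + 1) ^ k) {es es' : List (G.punctured x hx off d).E}
    {s s' : (G.punctured x hx off d).V}
    (h : (G.punctured x hx off d).IsWalk s es) (h' : (G.punctured x hx off d).IsWalk s' es')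
    (hs : s.1.1 = s'.1.1)
    (hl : es.map (G.punctured x hx off d).lab = es'.map (G.punctured x hx off d).lab)
    (hlen : es.length = k + 1) : s.1.2 ≤ s'.1.2 := by
  obtain _ | ⟨f, es⟩ := es
  · simp at hlen
  obtain _ | ⟨f', es'⟩ := es'
  · simp at hl
  rw [List.map_cons, List.map_cons, List.cons.injEq] at hl
  obtain rfl : es.length = k := by simpa using hlen
  obtain ⟨rfl, h⟩ := h
  obtain ⟨rfl, h'⟩ := h'
  have he := punctured_edge_eq hdet hs hl.1
  have hj : f.1.2 ≤ f'.1.2 + (n + 1) ^ (es.length - es.length) :=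
    punctured_index_le hdet hd hk h h' (congrArg G.dst he) hl.2 le_rfl
  rw [Nat.sub_self, pow_zero] at hj
  have hmod := f'.2.2.1
  change (off f.1.1 + f.1.2) / (d f.1.1 + 1) ≤ (off f'.1.1 + f'.1.2) / (d f'.1.1 + 1)
  rw [← he] at hmod ⊢
  exact div_le_div_of_le_succ hmod (by omega)

/-- The first edge of a path is determined by its initial state in `G` together with the first
`k + 2` symbols. -/
theorem punctured_head?_eq (hdet : G.Deterministic) {n k : ℕ} (hd : ∀ e, n ≤ d e)
    (hk : ∀ v, x v ≤ (n + 1) ^ k) {es es' : List (G.punctured x hx off d).E}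
    {s s' : (G.punctured x hx off d).V}
    (h : (G.punctured x hx off d).IsWalk s es) (h' : (G.punctured x hx off d).IsWalk s' es')
    (hs : s.1.1 = s'.1.1)
    (hl : es.map (G.punctured x hx off d).lab = es'.map (G.punctured x hx off d).lab)
    (hlen : es.length = k + 2) : es.head? = es'.head? := by
  obtain _ | ⟨f, es⟩ := es
  · simp at hlen
  obtain _ | ⟨f', es'⟩ := es'
  · simp at hl
  rw [List.map_cons, List.map_cons, List.cons.injEq] at hl
  obtain ⟨rfl, h⟩ := h
  obtain ⟨rfl, h'⟩ := h'
  have he := punctured_edge_eq hdet hs hl.1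
  have hlen1 : es.length = k + 1 := by simpa using hlen
  have hlen2 : es'.length = k + 1 := by
    rw [← hlen1]
    simpa using congrArg List.length hl.2.symm
  have hj : f.1.2 = f'.1.2 := le_antisymm
    (punctured_index_eq hdet hd hk h h' (congrArg G.dst he) hl.2 hlen1)
    (punctured_index_eq hdet hd hk h' h (congrArg G.dst he.symm) hl.2.symm hlen2)
  exact congrArg some (Subtype.ext (Prod.ext he hj))

theorem punctured_definite (hdet : G.Deterministic) {n k μ : ℕ} (hd : ∀ e, n ≤ d e)
    (hk : ∀ v, x v ≤ (n + 1) ^ k) (hμ : G.MemoryAtMost μ) :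
    (G.punctured x hx off d).Definite μ (1 + k) := by
  intro s s' es es' h h' hlen hlen' hl
  rw [← List.take_append_drop μ es] at h
  rw [← List.take_append_drop μ es'] at h'
  obtain ⟨h1, h2⟩ := IsWalk.append h
  obtain ⟨h1', h2'⟩ := IsWalk.append h'
  rw [← List.head?_drop, ← List.head?_drop]
  refine punctured_head?_eq hdet hd hk h2 h2' ?_ ?_ ?_
  · rw [← punctured_endState_map, ← punctured_endState_map]
    refine hμ _ _ _ _ (punctured_isWalk_map h1) (punctured_isWalk_map h1') ?_ ?_ ?_
    · rw [List.length_map, List.length_take]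
      omega
    · rw [List.length_map, List.length_take]
      omega
    · rw [punctured_map_lab, punctured_map_lab, List.map_take, List.map_take, hl]
  · rw [List.map_drop, List.map_drop, hl]
  · rw [List.length_drop]
    omega

end Punctured

end LGraph


/-- If `X(A_{G_0},A_{G_1},n0+1,n1+1) ≠ ∅` for a deterministic
labeled graph `G`, then there is an `(S(G),n0,n1)`-encoder whose anticipation
is at most `a = 1 + min_{x ∈ X(A_{G_0},A_{G_1},n0+1,n1+1)} ⌈log_{n+1} ‖x‖_∞⌉`,
where `n = min {n0, n1}`; moreover, if `G` has finite memory `μ`, the encoder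
can be chosen `(μ,a)`-definite. -/
theorem punctured_stethering_encoder {A : Type*} (G : LGraph A) (S0 S1 : Set A)
    (hdisj : Disjoint S0 S1) (hcover : S0 ∪ S1 = Set.univ)
    (hdet : G.Deterministic)
    (n0 n1 : ℕ) (hn0 : 0 < n0) (hn1 : 0 < n1)
    (hne : ∃ x : G.V → ℕ, G.InX S0 S1 (n0 + 1) (n1 + 1) x)
    (a : ℕ)
    (ha : a = 1 + sInf {m : ℕ | ∃ x : G.V → ℕ, G.InX S0 S1 (n0 + 1) (n1 + 1) x ∧
      m = Nat.clog (min n0 n1 + 1) (Finset.univ.sup x)}) :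
    ∃ En : LGraph A, LGraph.IsEncoder En G.constraint S0 S1 n0 n1 ∧
      LGraph.AnticipationAtMost En a ∧
      ∀ μ : ℕ, LGraph.MemoryAtMost G μ → LGraph.Definite En μ a := by
  obtain ⟨x, ⟨hx, hx0, hx1⟩, hm⟩ := Nat.sInf_mem (s := {m : ℕ | ∃ x : G.V → ℕ,
    G.InX S0 S1 (n0 + 1) (n1 + 1) x ∧ m = Nat.clog (min n0 n1 + 1) (Finset.univ.sup x)})
    (hne.imp' _ fun x h => ⟨x, h, rfl⟩)
  rw [hm] at ha
  subst ha
  set k := Nat.clog (min n0 n1 + 1) (Finset.univ.sup x)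
  have hk : ∀ v, x v ≤ (min n0 n1 + 1) ^ k := fun v =>
    (Finset.le_sup (Finset.mem_univ v)).trans (Nat.le_pow_clog (by omega) _)
  obtain ⟨o0, h0⟩ := G.exists_isLayout S0 x
  obtain ⟨o1, h1⟩ := G.exists_isLayout S1 x
  have hS1 : ∀ e, G.lab e ∈ S1 → G.lab e ∉ S0 := fun e he => hdisj.notMem_of_mem_right he
  let off : G.E → ℕ := fun e => if G.lab e ∈ S0 then o0 e else o1 e
  let d : G.E → ℕ := fun e => if G.lab e ∈ S0 then n0 else n1
  have hd : ∀ e, min n0 n1 ≤ d e := fun e => by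
    simp only [d]
    split_ifs
    exacts [min_le_left _ _, min_le_right _ _]
  have hoff0 : ∀ e, G.lab e ∈ S0 → off e = o0 e := fun e he => if_pos he
  have hoff1 : ∀ e, G.lab e ∈ S1 → off e = o1 e := fun e he => if_neg (hS1 e he)
  refine ⟨G.punctured x hx off d,
    ⟨LGraph.punctured_lossless hdet, LGraph.punctured_constraint,
      LGraph.punctured_outDeg (fun e he => if_pos he) (h0.congr hoff0) hx0,
      LGraph.punctured_outDeg (fun e he => if_neg (hS1 e he)) (h1.congr hoff1) hx1⟩,
    fun s es es' h h' hlen _ hl =>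
      LGraph.punctured_head?_eq hdet hd hk h h' rfl hl (by omega),
    fun μ hμ => LGraph.punctured_definite hdet hd hk hμ⟩
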